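/- Fix θ₀ = (σ₀,δ₀,α₀) with σ₀ > 0, δ₀ > 0, α₀ ∈ (0,2). There exist C > 0 and N ∈ ℕ such that for all n ≥ N: | ∫_ℝ (g_{α₀}(y, w_n(θ₀))² / f_{α₀}(y, w_n(θ₀))) dy − 2 | ≤ C n^{−(1−α₀/2)/2}. (Here 2 = ∫_ℝ (D(φ)(y))²/φ(y) dy = ∫_ℝ (1−y²)² φ(y) dy.) -/

import Mathlib

open MeasureTheory Filter Set Topology Matrix

noncomputable section

namespace LevyLAN

/-- Standard Gaussian density `φ`. -/
def gauss (y : ℝ) : ℝ := (Real.sqrt (2 * Real.pi))⁻¹ * Real.exp (-(y ^ 2) / 2)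

/-- Symmetric `α`-stable density `φ_α`, defined by Fourier inversion. -/
def stableDensity (α z : ℝ) : ℝ :=
  (2 * Real.pi)⁻¹ * ∫ u : ℝ, Real.cos (z * u) * Real.exp (-(|u| ^ α))

/-- `∂_α φ_α`. -/
def stableDensityDalpha (α z : ℝ) : ℝ :=
  -(2 * Real.pi)⁻¹ * ∫ u : ℝ, Real.cos (z * u) * |u| ^ α * Real.log |u| * Real.exp (-(|u| ^ α))

/-- The operator `(D f) y = (y * f y)' = f y + y * f' y`. -/
def Dop (f : ℝ → ℝ) (y : ℝ) : ℝ := f y + y * deriv f y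

/-- `f_α(y, w)`. -/
def fFun (α y w : ℝ) : ℝ := ∫ z : ℝ, gauss (y - w * z) * stableDensity α z

/-- `g_α(y, w)`. -/
def gFun (α y w : ℝ) : ℝ := ∫ z : ℝ, Dop gauss (y - w * z) * stableDensity α z

/-- `h_α(y, w)`. -/
def hFun (α y w : ℝ) : ℝ := ∫ z : ℝ, gauss (y - w * z) * Dop (stableDensity α) z

/-- `k_α(y, w)`. -/
def kFun (α y w : ℝ) : ℝ := ∫ z : ℝ, gauss (y - w * z) * stableDensityDalpha α z

/-- `c_α`. -/
def cAlpha (α : ℝ) : ℝ :=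
  if α = 1 then 1 / Real.pi
  else -(α * (α - 1)) / (2 * Real.Gamma (2 - α) * Real.cos (Real.pi * α / 2))

/-- `w_n(θ) = n^{1/2 - 1/α} δ / σ`. -/
def wn (n : ℕ) (σ δ α : ℝ) : ℝ := (n : ℝ) ^ ((1 : ℝ) / 2 - 1 / α) * δ / σ

/-- `l_α(y, w)` (it depends on `n`). -/
def lFun (n : ℕ) (α y w : ℝ) : ℝ :=
  ((Real.log n - Real.log (Real.log n)) / (2 * α) - Real.log n / α ^ 2) * hFun α y w
    + kFun α y w

def kappa0 (σ δ α : ℝ) : ℝ := 2 * cAlpha α / (α * (2 - α) ^ (α / 2)) * (δ / σ) ^ α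

def kappa1 (σ δ α : ℝ) : ℝ :=
  Real.log (δ / σ) + deriv cAlpha α / cAlpha α - Real.log (2 - α) / 2 - 1 / α

/-- The density `p_{1/n}(y, θ)`, with parameter `θ = (σ, δ, α) : Fin 3 → ℝ`. -/
def pdens (n : ℕ) (θ : Fin 3 → ℝ) (y : ℝ) : ℝ :=
  Real.sqrt n / θ 0 * fFun (θ 2) (Real.sqrt n * y / θ 0) (wn n (θ 0) (θ 1) (θ 2))

/-- The log-likelihood `ln L_n(θ)`. -/
def logLik (n : ℕ) (θ : Fin 3 → ℝ) (x : Fin n → ℝ) : ℝ :=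
  ∑ i, Real.log (pdens n θ (x i))

/-- Partial derivative in the `j`-th parameter coordinate. -/
def pderiv (j : Fin 3) (F : (Fin 3 → ℝ) → ℝ) (θ : Fin 3 → ℝ) : ℝ :=
  deriv (fun t => F (Function.update θ j t)) (θ j)

/-- The score `G_n(θ) = ∇_θ ln L_n(θ)`. -/
def scoreVec (n : ℕ) (θ : Fin 3 → ℝ) (x : Fin n → ℝ) : Fin 3 → ℝ :=
  fun j => pderiv j (fun θ' => logLik n θ' x) θ

/-- The Hessian matrix `J_n(θ)` of the log-likelihood. -/
def hessMat (n : ℕ) (θ : Fin 3 → ℝ) (x : Fin n → ℝ) : Matrix (Fin 3) (Fin 3) ℝ :=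
  Matrix.of fun i j => pderiv i (fun θ' => pderiv j (fun θ'' => logLik n θ'' x) θ') θ

def rate (n : ℕ) (α : ℝ) : ℝ := Real.log n ^ (α / 4) / (n : ℝ) ^ (α / 4)

/-- The rate matrix `u_n(θ)`. -/
def un (n : ℕ) (θ : Fin 3 → ℝ) : Matrix (Fin 3) (Fin 3) ℝ :=
  !![1 / Real.sqrt n, 0, 0;
     0, rate n (θ 2), -(rate n (θ 2) * (θ 1 / (2 * θ 2)) * (Real.log n - Real.log (Real.log n)));
     0, 0, rate n (θ 2)]

/-- The information matrix `I(θ)`. -/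
def Imat (θ : Fin 3 → ℝ) : Matrix (Fin 3) (Fin 3) ℝ :=
  !![2 / θ 0 ^ 2, 0, 0;
     0, θ 2 ^ 2 / θ 1 ^ 2 * kappa0 (θ 0) (θ 1) (θ 2),
        θ 2 / θ 1 * kappa0 (θ 0) (θ 1) (θ 2) * kappa1 (θ 0) (θ 1) (θ 2);
     0, θ 2 / θ 1 * kappa0 (θ 0) (θ 1) (θ 2) * kappa1 (θ 0) (θ 1) (θ 2),
        kappa0 (θ 0) (θ 1) (θ 2) * (kappa1 (θ 0) (θ 1) (θ 2) ^ 2 + 1 / θ 2 ^ 2)]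

/-- `ℙ_n`, the `n`-fold product of the law with Lebesgue density `p_{1/n}(·, θ)`. -/
def Pn (n : ℕ) (θ : Fin 3 → ℝ) : Measure (Fin n → ℝ) :=
  Measure.pi fun _ => MeasureTheory.volume.withDensity fun y => ENNReal.ofReal (pdens n θ y)

/-- The standard Gaussian measure on `ℝ³`. -/
def stdGauss3 : Measure (Fin 3 → ℝ) :=
  Measure.pi fun _ => ProbabilityTheory.gaussianReal 0 1

/-- Euclidean (Frobenius) norm of a real 3×3 matrix. -/
def frobNorm (M : Matrix (Fin 3) (Fin 3) ℝ) : ℝ := Real.sqrt (∑ i, ∑ j, M i j ^ 2)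

/-- Euclidean norm of a vector of `ℝ³`. -/
def vecNorm (v : Fin 3 → ℝ) : ℝ := Real.sqrt (∑ j, v j ^ 2)

/-- The admissible families of functions `ψ_α^{(p)}`. -/
structure IsPsiFamily (ψ : ℝ → ℕ → ℝ → ℝ) : Prop where
  contDiff : ∀ α ∈ Set.Ioo (0 : ℝ) 2, ∀ p : ℕ, ContDiff ℝ 2 (ψ α p)
  pos : ∀ α ∈ Set.Ioo (0 : ℝ) 2, ∀ p : ℕ, ∀ y : ℝ, 0 < ψ α p y
  even : ∀ α ∈ Set.Ioo (0 : ℝ) 2, ∀ p : ℕ, ∀ y : ℝ, ψ α p (-y) = ψ α p y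
  eq_one : ∀ α ∈ Set.Ioo (0 : ℝ) 2, ∀ p : ℕ, ∀ y : ℝ, |y| ≤ 1 → ψ α p y = 1
  eq_tail : ∀ α ∈ Set.Ioo (0 : ℝ) 2, ∀ p : ℕ, ∀ y : ℝ, 3 ≤ |y| →
    ψ α p y = Real.log |y| ^ p / |y| ^ (α + 1)
  unifBound : ∀ K : Set ℝ, K ⊆ Set.Ioo (0 : ℝ) 2 → IsCompact K → ∀ p : ℕ,
    ∃ c > (0 : ℝ), ∃ C : ℝ, ∀ α ∈ K, ∀ y : ℝ, 1 ≤ |y| → |y| ≤ 3 →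
      c ≤ ψ α p y ∧ ψ α p y ≤ C

/-- `𝓘_α^{(k,l)}`. -/
def Ical (ψ : ℝ → ℕ → ℝ → ℝ) (α : ℝ) (k l : ℕ) (y : ℝ) : ℝ :=
  ∫ z in {z : ℝ | 1 < |z|}, Dop^[k] gauss (y - z) * ψ α l z

/-- `f_α^{(k,l,m)}`. -/
def fklm (α : ℝ) (k l m : ℕ) (y w : ℝ) : ℝ :=
  ∫ z : ℝ, Dop^[k] gauss (y - w * z)
    * Dop^[l] (fun z' => iteratedDeriv m (fun a => stableDensity a z') α) z

def Gamman (n : ℕ) (α : ℝ) : ℝ := Real.sqrt ((1 - α / 2) * Real.log n)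

def Mn (n : ℕ) (α : ℝ) : ℝ := Real.sqrt ((2 - α) * Real.log n)

def Kconst (σ δ α : ℝ) : ℝ := deriv cAlpha α + cAlpha α * Real.log (δ / σ)


structure PQ (F : ℝ → ℝ) : Prop where
  cont : Continuous F
  bdd : ∃ B, ∀ u, ‖F u‖ ≤ B
  nonneg : ∀ z ε : ℝ, 0 < ε → 0 ≤ ∫ u, Real.cos (z * u) * F u * Real.exp (-ε * u ^ 2)

lemma PQ.integrable {F : ℝ → ℝ} (hF : PQ F) (z ε : ℝ) (hε : 0 < ε) :
    Integrable fun u => Real.cos (z * u) * F u * Real.exp (-ε * u ^ 2) := by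
  obtain ⟨B, hB⟩ := hF.bdd
  refine (integrable_exp_neg_mul_sq hε).bdd_mul (c := B) ?_ (ae_of_all _ fun u => ?_)
  · have := hF.cont
    exact Continuous.aestronglyMeasurable (by fun_prop)
  · rw [norm_mul]
    calc _ ≤ 1 * B := mul_le_mul (Real.abs_cos_le_one _) (hB u) (norm_nonneg _) zero_le_one
      _ = B := one_mul B

lemma gauss_cos (z ε : ℝ) (hε : 0 < ε) :
    ∫ u : ℝ, Real.cos (z * u) * Real.exp (-ε * u ^ 2) =
      Real.sqrt (Real.pi / ε) * Real.exp (-(z ^ 2 / (4 * ε))) := by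
  have h := fourierIntegral_gaussian (b := (ε : ℂ)) (by simpa using hε) (z : ℂ)
  have h2 : (∫ u : ℝ, Complex.exp (Complex.I * z * u) * Complex.exp (-ε * u ^ 2)).re =
      ∫ u : ℝ, Real.cos (z * u) * Real.exp (-ε * u ^ 2) := by
    have hi : Integrable fun u : ℝ =>
        Complex.exp (Complex.I * z * u) * Complex.exp (-ε * u ^ 2) := by
      have := integrable_cexp_quadratic (b := (ε:ℂ)) (by simpa using hε) (Complex.I * z) 0
      refine this.congr (ae_of_all _ fun u => ?_)
      simp only [← Complex.exp_add]
      congr 1; ring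
    rw [← RCLike.re_eq_complex_re, ← integral_re hi]
    refine integral_congr_ae (ae_of_all _ fun u => ?_)
    have e1 : Complex.exp (-ε * u ^ 2) = ((Real.exp (-ε * u ^ 2) : ℝ) : ℂ) := by
      push_cast; rfl
    have e2 : Complex.I * z * u = ((z * u : ℝ) : ℂ) * Complex.I := by push_cast; ring
    simp only [RCLike.re_eq_complex_re]
    rw [e1, e2, Complex.re_mul_ofReal, Complex.exp_ofReal_mul_I_re]
  rw [← h2, h]
  have e3 : (Real.pi / (ε:ℂ)) ^ (1 / 2 : ℂ) = ((Real.sqrt (Real.pi / ε) : ℝ) : ℂ) := by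
    rw [Real.sqrt_eq_rpow, Complex.ofReal_cpow (by positivity)]
    push_cast; rfl
  have e4 : Complex.exp (-(z:ℂ) ^ 2 / (4 * ε)) = ((Real.exp (-(z ^ 2 / (4 * ε))) : ℝ) : ℂ) := by
    push_cast; congr 1; ring
  rw [e3, e4, ← Complex.ofReal_mul, Complex.ofReal_re]

lemma PQ.one : PQ fun _ => 1 where
  cont := continuous_const
  bdd := ⟨1, fun _ => by simp⟩
  nonneg z ε hε := by
    simp only [mul_one]
    rw [gauss_cos z ε hε]; positivity

def mixG (ρ : ℝ → ℝ) (u : ℝ) : ℝ := ∫ s, Real.exp (-(|s| * u ^ 2)) * ρ s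

lemma exp_le_one' (s u : ℝ) : Real.exp (-(|s| * u ^ 2)) ≤ 1 := by
  rw [Real.exp_le_one_iff]; have := mul_nonneg (abs_nonneg s) (sq_nonneg u); linarith

lemma mixG_int {ρ : ℝ → ℝ} (hρ : Integrable ρ) (u : ℝ) :
    Integrable fun s => Real.exp (-(|s| * u ^ 2)) * ρ s := by
  refine hρ.bdd_mul (c := 1) (Continuous.aestronglyMeasurable (by fun_prop))
    (ae_of_all _ fun s => ?_)
  rw [Real.norm_of_nonneg (Real.exp_pos _).le]; exact exp_le_one' s u

lemma mixG_cont {ρ : ℝ → ℝ} (hρ : Integrable ρ) : Continuous (mixG ρ) := by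
  refine continuous_of_dominated (bound := fun s => ‖ρ s‖)
    (fun u => (mixG_int hρ u).aestronglyMeasurable)
    (fun u => ae_of_all _ fun s => ?_) hρ.norm (ae_of_all _ fun s => by fun_prop)
  rw [norm_mul, Real.norm_of_nonneg (Real.exp_pos _).le]
  exact mul_le_of_le_one_left (norm_nonneg _) (exp_le_one' s u)

lemma mixG_le {ρ : ℝ → ℝ} (hρ : Integrable ρ) (h0 : ∀ s, 0 ≤ ρ s) (u : ℝ) :
    mixG ρ u ≤ ∫ s, ρ s :=
  integral_mono (mixG_int hρ u) hρ fun s => mul_le_of_le_one_left (h0 s) (exp_le_one' s u)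

lemma mixG_nonneg {ρ : ℝ → ℝ} (h0 : ∀ s, 0 ≤ ρ s) (u : ℝ) : 0 ≤ mixG ρ u :=
  integral_nonneg fun s => mul_nonneg (Real.exp_pos _).le (h0 s)

lemma PQ.mul_mix {F : ℝ → ℝ} (hF : PQ F) {ρ : ℝ → ℝ} (hρ : Integrable ρ) (h0 : ∀ s, 0 ≤ ρ s) :
    PQ fun u => F u * mixG ρ u where
  cont := hF.cont.mul (mixG_cont hρ)
  bdd := by
    obtain ⟨B, hB⟩ := hF.bdd
    refine ⟨B * ∫ s, ρ s, fun u => ?_⟩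
    rw [norm_mul, Real.norm_of_nonneg (mixG_nonneg h0 u)]
    exact mul_le_mul (hB u) (mixG_le hρ h0 u) (mixG_nonneg h0 u) ((norm_nonneg _).trans (hB u))
  nonneg z ε hε := by
    have h1 : ∀ u, Real.cos (z * u) * (F u * mixG ρ u) * Real.exp (-ε * u ^ 2) =
        ∫ s, (Real.cos (z * u) * F u * Real.exp (-ε * u ^ 2)) *
          (Real.exp (-(|s| * u ^ 2)) * ρ s) := by
      intro u; rw [integral_const_mul, mixG]; ring
    simp_rw [h1]
    rw [integral_integral_swap]
    · refine integral_nonneg fun s => ?_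
      have h2 := hF.nonneg z (ε + |s|) (by positivity)
      have h3 : ∀ u, (Real.cos (z * u) * F u * Real.exp (-ε * u ^ 2)) *
          (Real.exp (-(|s| * u ^ 2)) * ρ s) =
          (Real.cos (z * u) * F u * Real.exp (-(ε + |s|) * u ^ 2)) * ρ s := by
        intro u
        rw [show -(ε + |s|) * u ^ 2 = -ε * u ^ 2 + -(|s| * u ^ 2) by ring, Real.exp_add]; ring
      simp only [Pi.zero_apply]
      simp_rw [h3]
      rw [integral_mul_const]
      exact mul_nonneg h2 (h0 s)
    · have := (hF.integrable z ε hε).mul_prod hρ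
      have h4 := this.bdd_mul (c := 1) (f := fun q : ℝ × ℝ => Real.exp (-(|q.2| * q.1 ^ 2)))
        (Continuous.aestronglyMeasurable (by fun_prop)) (ae_of_all _ fun q => by
          rw [Real.norm_of_nonneg (Real.exp_pos _).le]; exact exp_le_one' _ _)
      refine h4.congr (ae_of_all _ fun q => ?_)
      simp only [Function.uncurry]; ring

lemma PQ.add {F G : ℝ → ℝ} (hF : PQ F) (hG : PQ G) : PQ fun u => F u + G u where
  cont := hF.cont.add hG.cont
  bdd := by
    obtain ⟨B, hB⟩ := hF.bdd
    obtain ⟨B', hB'⟩ := hG.bdd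
    exact ⟨B + B', fun u => (norm_add_le _ _).trans (add_le_add (hB u) (hB' u))⟩
  nonneg z ε hε := by
    simp_rw [mul_add, add_mul]
    rw [integral_add (hF.integrable z ε hε) (hG.integrable z ε hε)]
    exact add_nonneg (hF.nonneg z ε hε) (hG.nonneg z ε hε)

lemma PQ.smul {F : ℝ → ℝ} (hF : PQ F) (c : ℝ) (hc : 0 ≤ c) : PQ fun u => c * F u where
  cont := continuous_const.mul hF.cont
  bdd := by
    obtain ⟨B, hB⟩ := hF.bdd
    refine ⟨c * B, fun u => ?_⟩
    rw [norm_mul, Real.norm_of_nonneg hc]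
    exact mul_le_mul_of_nonneg_left (hB u) hc
  nonneg z ε hε := by
    have : ∀ u, Real.cos (z * u) * (c * F u) * Real.exp (-ε * u ^ 2) =
      c * (Real.cos (z * u) * F u * Real.exp (-ε * u ^ 2)) := fun u => by ring
    simp_rw [this, integral_const_mul]
    exact mul_nonneg hc (hF.nonneg z ε hε)

/-- Closure under bounded pointwise limits. -/
lemma PQ.limit {F : ℕ → ℝ → ℝ} (hF : ∀ n, PQ (F n)) {L : ℝ → ℝ} (hL : Continuous L) (B : ℝ)
    (hB : ∀ n u, ‖F n u‖ ≤ B) (hlim : ∀ u, Tendsto (fun n => F n u) atTop (𝓝 (L u))) : PQ L where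
  cont := hL
  bdd := ⟨B, fun u => le_of_tendsto (hlim u).norm (Eventually.of_forall fun n => hB n u)⟩
  nonneg z ε hε := by
    refine ge_of_tendsto' (tendsto_integral_of_dominated_convergence
      (fun u => B * Real.exp (-ε * u ^ 2)) (F := fun n u =>
        Real.cos (z * u) * F n u * Real.exp (-ε * u ^ 2))
      (fun n => ((hF n).integrable z ε hε).aestronglyMeasurable)
      ((integrable_exp_neg_mul_sq hε).const_mul B) (fun n => ae_of_all _ fun u => ?_)
      (ae_of_all _ fun u => ((hlim u).const_mul _).mul_const _)) fun n => (hF n).nonneg z ε hε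
    rw [norm_mul, norm_mul, Real.norm_of_nonneg (Real.exp_pos _).le]
    refine mul_le_mul_of_nonneg_right ?_ (Real.exp_pos _).le
    calc _ ≤ 1 * B := mul_le_mul (Real.abs_cos_le_one _) (hB n u) (norm_nonneg _) zero_le_one
      _ = B := one_mul B

lemma PQ.exp_mix {ρ : ℝ → ℝ} (hρ : Integrable ρ) (h0 : ∀ s, 0 ≤ ρ s) :
    PQ fun u => Real.exp (-((∫ s, ρ s) - mixG ρ u)) := by
  have key : PQ fun u => Real.exp (mixG ρ u) := by
    refine PQ.limit (F := fun n u => (1 + mixG ρ u / n) ^ n) ?_ ?_ (Real.exp (∫ s, ρ s)) ?_ ?_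
    · intro n
      have : ∀ m : ℕ, PQ fun u => (1 + mixG ρ u / n) ^ m := by
        intro m
        induction m with
        | zero => simpa using PQ.one
        | succ m ih =>
          have := ih.add ((ih.mul_mix hρ h0).smul (1 / n) (by positivity))
          convert this using 2 with u
          ring
      exact this n
    · exact Real.continuous_exp.comp (mixG_cont hρ)
    · intro n u
      have h1 := mixG_nonneg h0 u
      rw [Real.norm_of_nonneg (by positivity)]
      have : (1 + mixG ρ u / n) ^ n ≤ Real.exp (mixG ρ u) := by
        rcases Nat.eq_zero_or_pos n with rfl | hn
        · simpa using Real.one_le_exp h1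
        · calc (1 + mixG ρ u / n) ^ n ≤ (Real.exp (mixG ρ u / n)) ^ n := by
                gcongr
                rw [add_comm]; exact Real.add_one_le_exp _
            _ = _ := by rw [← Real.exp_nat_mul]; congr 1; field_simp
      exact this.trans (Real.exp_le_exp.2 (mixG_le hρ h0 u))
    · intro u; exact Real.tendsto_one_add_div_pow_exp _
  have := key.smul (Real.exp (-∫ s, ρ s)) (Real.exp_pos _).le
  convert this using 2 with u
  rw [← Real.exp_add]; congr 1; ring


lemma levy_int {β : ℝ} (h0 : 0 < β) (h1 : β < 1) (x : ℝ) (hx : 0 ≤ x) :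
    IntegrableOn (fun s : ℝ => (1 - Real.exp (-(s * x))) * s ^ (-1 - β)) (Ioi 0) := by
  rw [← Ioc_union_Ioi_eq_Ioi zero_le_one]
  have hm : ∀ S : Set ℝ, AEStronglyMeasurable (fun s : ℝ => (1 - Real.exp (-(s * x))) * s ^ (-1 - β))
      (volume.restrict S) := fun S => by
    apply Measurable.aestronglyMeasurable; fun_prop
  have hb : ∀ s : ℝ, 0 < s → 0 ≤ 1 - Real.exp (-(s * x)) ∧ 1 - Real.exp (-(s * x)) ≤ 1 ∧
      1 - Real.exp (-(s * x)) ≤ s * x := by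
    intro s hs
    refine ⟨?_, ?_, ?_⟩
    · have : Real.exp (-(s * x)) ≤ 1 := by
        rw [Real.exp_le_one_iff]; have := mul_nonneg hs.le hx; linarith
      linarith
    · have := Real.exp_pos (-(s * x)); linarith
    · have := Real.add_one_le_exp (-(s * x)); linarith
  apply IntegrableOn.union
  · have : IntegrableOn (fun s : ℝ => x * s ^ (-β)) (Ioc 0 1) := by
      have := (intervalIntegral.intervalIntegrable_rpow' (a := 0) (b := 1) (r := -β) (by linarith))
      rw [intervalIntegrable_iff_integrableOn_Ioc_of_le zero_le_one] at this
      exact this.const_mul x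
    refine Integrable.mono' this (hm _) ?_
    refine (ae_restrict_iff' measurableSet_Ioc).2 (ae_of_all _ fun s hs => ?_)
    obtain ⟨b1, b2, b3⟩ := hb s hs.1
    have hp : 0 ≤ s ^ (-1 - β) := Real.rpow_nonneg hs.1.le _
    rw [Real.norm_of_nonneg (mul_nonneg b1 hp)]
    calc _ ≤ (s * x) * s ^ (-1 - β) := mul_le_mul_of_nonneg_right b3 hp
      _ = x * s ^ (-β) := by
        rw [show -β = 1 + (-1 - β) by ring, Real.rpow_add hs.1, Real.rpow_one]; ring
  · refine Integrable.mono' (integrableOn_Ioi_rpow_of_lt (a := -1 - β) (by linarith) zero_lt_one)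
      (hm _) ?_
    refine (ae_restrict_iff' measurableSet_Ioi).2 (ae_of_all _ fun s hs => ?_)
    have hs' : 0 < s := zero_lt_one.trans hs
    obtain ⟨b1, b2, b3⟩ := hb s hs'
    have hp : 0 ≤ s ^ (-1 - β) := Real.rpow_nonneg hs'.le _
    rw [Real.norm_of_nonneg (mul_nonneg b1 hp)]
    exact mul_le_of_le_one_left hp b2

def levyJ (β : ℝ) : ℝ := ∫ s in Ioi (0:ℝ), (1 - Real.exp (-(s * 1))) * s ^ (-1 - β)

lemma levyJ_pos {β : ℝ} (h0 : 0 < β) (h1 : β < 1) : 0 < levyJ β := by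
  have hp : ∀ s : ℝ, 0 < s → 0 < (1 - Real.exp (-(s * 1))) * s ^ (-1 - β) := by
    intro s hs
    refine mul_pos ?_ (Real.rpow_pos_of_pos hs _)
    have : Real.exp (-(s * 1)) < 1 := by rw [Real.exp_lt_one_iff]; linarith
    linarith
  unfold levyJ
  rw [setIntegral_pos_iff_support_of_nonneg_ae _ (levy_int h0 h1 1 zero_le_one)]
  · have : (Ioi (0:ℝ)) ⊆ (Function.support fun s : ℝ => (1 - Real.exp (-(s * 1))) * s ^ (-1 - β)) ∩ Ioi 0 :=
      fun s hs => ⟨(hp s hs).ne', hs⟩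
    refine lt_of_lt_of_le ?_ (measure_mono this)
    simp
  · exact (ae_restrict_iff' measurableSet_Ioi).2 (ae_of_all _ fun s hs => (hp s hs).le)

lemma levy_scale {β : ℝ} (h0 : 0 < β) (x : ℝ) (hx : 0 ≤ x) :
    ∫ s in Ioi (0:ℝ), (1 - Real.exp (-(s * x))) * s ^ (-1 - β) = x ^ β * levyJ β := by
  rcases hx.eq_or_lt with rfl | hx
  · simp [Real.zero_rpow h0.ne']
  · have h := integral_comp_mul_left_Ioi
      (fun s : ℝ => (1 - Real.exp (-(s * 1))) * s ^ (-1 - β)) 0 hx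
    rw [mul_zero] at h
    have e : ∀ s ∈ Ioi (0:ℝ), (1 - Real.exp (-(x * s * 1))) * (x * s) ^ (-1 - β) =
        x ^ (-1 - β) * ((1 - Real.exp (-(s * x))) * s ^ (-1 - β)) := by
      intro s hs
      rw [Real.mul_rpow hx.le (le_of_lt hs), mul_one, mul_comm x s]; ring
    rw [setIntegral_congr_fun measurableSet_Ioi e, integral_const_mul, smul_eq_mul] at h
    rw [levyJ]
    have h2 : x ^ (-1 - β) ≠ 0 := (Real.rpow_pos_of_pos hx _).ne'
    apply mul_left_cancel₀ h2
    rw [h, ← mul_assoc, ← Real.rpow_add hx]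
    rw [show -1 - β + β = -1 by ring, Real.rpow_neg_one]

lemma exp_stable_cont {α : ℝ} (h0 : 0 < α) : Continuous fun u : ℝ => Real.exp (-(|u| ^ α)) := by
  have : Continuous fun u : ℝ => |u| ^ α := continuous_abs.rpow_const fun _ => Or.inr h0.le
  fun_prop

lemma PQ_stable {α : ℝ} (h0 : 0 < α) (h2 : α < 2) : PQ fun u => Real.exp (-(|u| ^ α)) := by
  set β := α / 2 with hβ
  have hb0 : 0 < β := by positivity
  have hb1 : β < 1 := by rw [hβ]; linarith
  have hJ := levyJ_pos hb0 hb1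
  let d : ℕ → ℝ := fun n => 1 / ((n : ℝ) + 1)
  have hd : ∀ n, 0 < d n := fun n => by positivity
  let ρ : ℕ → ℝ → ℝ := fun n => (Ioi (d n)).indicator fun s => (levyJ β)⁻¹ * s ^ (-1 - β)
  have hρi : ∀ n, Integrable (ρ n) := fun n =>
    (integrable_indicator_iff measurableSet_Ioi).2
      ((integrableOn_Ioi_rpow_of_lt (by linarith) (hd n)).const_mul _)
  have hρ0 : ∀ n s, 0 ≤ ρ n s := fun n s => by
    refine indicator_nonneg (fun s hs => ?_) s
    have : 0 < s := (hd n).trans hs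
    positivity
  have hdiff : ∀ n u, (∫ s, ρ n s) - mixG (ρ n) u =
      (levyJ β)⁻¹ * ∫ s in Ioi (d n), (1 - Real.exp (-(s * u ^ 2))) * s ^ (-1 - β) := by
    intro n u
    rw [mixG, ← integral_sub (hρi n) (mixG_int (hρi n) u), ← integral_const_mul,
      ← integral_indicator measurableSet_Ioi]
    refine integral_congr_ae (ae_of_all _ fun s => ?_)
    by_cases hs : s ∈ Ioi (d n)
    · have : 0 < s := (hd n).trans hs
      simp only [ρ, indicator_of_mem hs, abs_of_pos this]; ring
    · simp [ρ, indicator_of_notMem hs]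
  have hle : ∀ n u, 0 ≤ (∫ s, ρ n s) - mixG (ρ n) u := fun n u =>
    sub_nonneg.2 (mixG_le (hρi n) (hρ0 n) u)
  refine PQ.limit (F := fun n u => Real.exp (-((∫ s, ρ n s) - mixG (ρ n) u)))
    (fun n => PQ.exp_mix (hρi n) (hρ0 n)) (exp_stable_cont h0) 1 ?_ ?_
  · intro n u
    rw [Real.norm_of_nonneg (Real.exp_pos _).le, Real.exp_le_one_iff]
    have := hle n u; linarith
  · intro u
    refine (Real.continuous_exp.tendsto _).comp (Tendsto.neg ?_)
    simp_rw [hdiff]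
    have hU : (⋃ n, Ioi (d n)) = Ioi 0 := by
      ext s
      simp only [mem_iUnion, mem_Ioi]
      exact ⟨fun ⟨n, hn⟩ => (hd n).trans hn, fun hs => exists_nat_one_div_lt hs⟩
    have hmono : Monotone fun n => Ioi (d n) := by
      intro m n hmn
      apply Ioi_subset_Ioi
      simp only [d]
      gcongr
    have ht := tendsto_setIntegral_of_monotone (μ := volume)
      (f := fun s : ℝ => (1 - Real.exp (-(s * u ^ 2))) * s ^ (-1 - β))
      (s := fun n => Ioi (d n)) (fun n => measurableSet_Ioi) hmono
      (by rw [hU]; exact levy_int hb0 hb1 _ (sq_nonneg u))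
    rw [hU, levy_scale hb0 _ (sq_nonneg u)] at ht
    have ht2 := ht.const_mul (levyJ β)⁻¹
    convert ht2 using 2
    rw [mul_comm _ (levyJ β), ← mul_assoc, inv_mul_cancel₀ hJ.ne', one_mul, ← sq_abs,
      ← Real.rpow_natCast, ← Real.rpow_mul (abs_nonneg u)]
    congr 1; rw [hβ]; push_cast; ring

lemma exp_stable_int {α : ℝ} (h0 : 0 < α) : Integrable fun u : ℝ => Real.exp (-(|u| ^ α)) := by
  have h := integrableOn_rpow_mul_exp_neg_rpow (p := α) (s := 0) (by norm_num) h0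
  simp only [Real.rpow_zero, one_mul] at h
  have h1 : IntegrableOn (fun u : ℝ => Real.exp (-(|u| ^ α))) (Ioi 0) :=
    h.congr_fun (fun u hu => by simp only [abs_of_pos (mem_Ioi.1 hu)]) measurableSet_Ioi
  have h2 : IntegrableOn (fun u : ℝ => Real.exp (-(|u| ^ α))) (Iio 0) := by
    have := h1.comp_neg
    simpa using this
  rw [← integrableOn_univ, ← Iic_union_Ioi (a := (0:ℝ)), integrableOn_union,
    integrableOn_Iic_iff_integrableOn_Iio]
  exact ⟨h2, h1⟩

lemma stable_nonneg {α : ℝ} (h0 : 0 < α) (h2 : α < 2) (z : ℝ) : 0 ≤ stableDensity α z := by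
  refine mul_nonneg (by positivity) ?_
  have hP := PQ_stable h0 h2
  have hd : ∀ n : ℕ, 0 < 1 / ((n : ℝ) + 1) := fun n => by positivity
  refine ge_of_tendsto' (tendsto_integral_of_dominated_convergence
      (fun u => Real.exp (-(|u| ^ α))) (F := fun (n : ℕ) u =>
        Real.cos (z * u) * Real.exp (-(|u| ^ α)) * Real.exp (-(1 / ((n : ℝ) + 1)) * u ^ 2))
      (fun n => (hP.integrable z _ (hd n)).aestronglyMeasurable)
      (exp_stable_int h0) (fun n => ae_of_all _ fun u => ?_)
      (ae_of_all _ fun u => ?_)) fun n => hP.nonneg z _ (hd n)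
  · rw [norm_mul, norm_mul, Real.norm_of_nonneg (Real.exp_pos _).le,
      Real.norm_of_nonneg (Real.exp_pos _).le]
    have e1 : Real.exp (-(1 / ((n : ℝ) + 1)) * u ^ 2) ≤ 1 := by
      rw [Real.exp_le_one_iff]
      have := mul_nonneg (hd n).le (sq_nonneg u); linarith
    calc _ ≤ 1 * Real.exp (-(|u| ^ α)) * 1 := by
          gcongr
          exact Real.abs_cos_le_one _
      _ = _ := by ring
  · have : Tendsto (fun n : ℕ => Real.exp (-(1 / ((n : ℝ) + 1)) * u ^ 2)) atTop (𝓝 1) := by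
      have h := (tendsto_one_div_add_atTop_nhds_zero_nat (𝕜 := ℝ)).neg.mul_const (u ^ 2)
      have := (Real.continuous_exp.tendsto _).comp h
      simpa [Function.comp_def] using this
    simpa using this.const_mul (Real.cos (z * u) * Real.exp (-(|u| ^ α)))


lemma stable_cont {α : ℝ} (h0 : 0 < α) : Continuous (stableDensity α) := by
  unfold stableDensity
  refine continuous_const.mul ?_
  have hc := exp_stable_cont h0
  refine continuous_of_dominated (bound := fun u => Real.exp (-(|u| ^ α)))
    (fun z => Continuous.aestronglyMeasurable (by fun_prop))
    (fun z => ae_of_all _ fun u => ?_) (exp_stable_int h0) (ae_of_all _ fun u => by fun_prop)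
  rw [norm_mul, Real.norm_of_nonneg (Real.exp_pos _).le]
  exact mul_le_of_le_one_left (Real.exp_pos _).le (Real.abs_cos_le_one _)

lemma gauss_pow_int (k : ℕ) : Integrable fun y => y ^ k * gauss y := by
  have h := integrable_rpow_mul_exp_neg_mul_sq (b := 1 / 2) (by norm_num) (s := k)
    (by have : (0:ℝ) ≤ k := Nat.cast_nonneg k
        linarith)
  have h2 := h.const_mul (Real.sqrt (2 * Real.pi))⁻¹
  refine h2.congr (ae_of_all _ fun y => ?_)
  simp only [gauss, Real.rpow_natCast]
  rw [show -(1 / 2) * y ^ 2 = -(y ^ 2) / 2 by ring]; ring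

lemma gauss_int : Integrable gauss := by simpa using gauss_pow_int 0

lemma gauss_pos (y : ℝ) : 0 < gauss y := by unfold gauss; positivity

lemma gauss_cont : Continuous gauss := by unfold gauss; fun_prop

lemma gauss_integral : ∫ y, gauss y = 1 := by
  unfold gauss
  rw [integral_const_mul]
  have := integral_gaussian (1 / 2)
  have e : ∀ y : ℝ, -(1 / 2) * y ^ 2 = -(y ^ 2) / 2 := fun y => by ring
  simp_rw [e] at this
  rw [this, show Real.pi / (1 / 2) = 2 * Real.pi by ring]
  exact inv_mul_cancel₀ (by positivity)

lemma gauss_abs_int {α : ℝ} (h0 : 0 < α) (h2 : α < 2) : Integrable fun u => gauss u * |u| ^ α := by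
  refine Integrable.mono' (gauss_int.add (gauss_pow_int 2)) ?_ (ae_of_all _ fun u => ?_)
  · have : Continuous fun u : ℝ => |u| ^ α := continuous_abs.rpow_const fun _ => Or.inr h0.le
    have := gauss_cont
    exact Continuous.aestronglyMeasurable (by fun_prop)
  · have hg := gauss_pos u
    have hr : |u| ^ α ≤ 1 + u ^ 2 := by
      rcases le_total |u| 1 with h | h
      · have := Real.rpow_le_one (abs_nonneg u) h h0.le
        nlinarith [sq_nonneg u]
      · have := Real.rpow_le_rpow_of_exponent_le h h2.le
        rw [Real.rpow_two, sq_abs] at this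
        linarith
    rw [Real.norm_of_nonneg (by positivity)]
    simp only [Pi.add_apply]
    nlinarith

def C0 (α : ℝ) : ℝ := ∫ u, gauss u * |u| ^ α

lemma C0_nonneg (α : ℝ) : 0 ≤ C0 α :=
  integral_nonneg fun u => mul_nonneg (gauss_pos u).le (Real.rpow_nonneg (abs_nonneg u) _)

lemma exp_sq_int {a : ℝ} (ha : 0 < a) : Integrable fun z : ℝ => Real.exp (-((a * z) ^ 2 / 2)) := by
  have := integrable_exp_neg_mul_sq (b := a ^ 2 / 2) (by positivity)
  refine this.congr (ae_of_all _ fun z => ?_)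
  simp only; congr 1; ring

lemma stable_gauss {α : ℝ} (h0 : 0 < α) {a : ℝ} (ha : 0 < a) :
    ∫ z, stableDensity α z * Real.exp (-((a * z) ^ 2 / 2)) =
      ∫ u, gauss u * Real.exp (-(a ^ α * |u| ^ α)) := by
  have h1 : ∀ z, stableDensity α z * Real.exp (-((a * z) ^ 2 / 2)) =
      ∫ u, (2 * Real.pi)⁻¹ * (Real.cos (u * z) * Real.exp (-((a * z) ^ 2 / 2)) *
        Real.exp (-(|u| ^ α))) := by
    intro z
    rw [stableDensity, mul_assoc, ← integral_mul_const, ← integral_const_mul]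
    refine integral_congr_ae (ae_of_all _ fun u => ?_)
    simp only
    rw [mul_comm z u]; ring
  simp_rw [h1]
  rw [integral_integral_swap]
  · have h2 : ∀ u : ℝ, ∫ z, (2 * Real.pi)⁻¹ * (Real.cos (u * z) * Real.exp (-((a * z) ^ 2 / 2)) *
        Real.exp (-(|u| ^ α))) = a⁻¹ * (gauss (a⁻¹ * u) * Real.exp (-(a ^ α * |a⁻¹ * u| ^ α))) := by
      intro u
      have h3 := gauss_cos u (a ^ 2 / 2) (by positivity)
      have e : ∀ z : ℝ, -(a ^ 2 / 2) * z ^ 2 = -((a * z) ^ 2 / 2) := fun z => by ring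
      simp_rw [e] at h3
      rw [integral_const_mul, integral_mul_const, h3, gauss]
      have e2 : a ^ α * |a⁻¹ * u| ^ α = |u| ^ α := by
        rw [abs_mul, abs_of_pos (inv_pos.2 ha), Real.mul_rpow (by positivity) (abs_nonneg _),
          ← mul_assoc, ← Real.mul_rpow ha.le (by positivity), mul_inv_cancel₀ ha.ne',
          Real.one_rpow, one_mul]
      have e3 : -(a⁻¹ * u) ^ 2 / 2 = -(u ^ 2 / (4 * (a ^ 2 / 2))) := by field_simp; norm_num
      have e4 : (2 * Real.pi)⁻¹ * Real.sqrt (Real.pi / (a ^ 2 / 2)) =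
          a⁻¹ * (Real.sqrt (2 * Real.pi))⁻¹ := by
        rw [show Real.pi / (a ^ 2 / 2) = (2 * Real.pi) / a ^ 2 by field_simp,
          Real.sqrt_div (by positivity), Real.sqrt_sq ha.le]
        have hs : Real.sqrt (2 * Real.pi) ^ 2 = 2 * Real.pi := Real.sq_sqrt (by positivity)
        have hp : 0 < Real.sqrt (2 * Real.pi) := by positivity
        nth_rewrite 1 [← hs]
        field_simp
      rw [e2, e3]
      calc _ = ((2 * Real.pi)⁻¹ * Real.sqrt (Real.pi / (a ^ 2 / 2))) *
            (Real.exp (-(u ^ 2 / (4 * (a ^ 2 / 2)))) * Real.exp (-|u| ^ α)) := by ring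
        _ = _ := by rw [e4]; ring
    simp_rw [h2]
    rw [integral_const_mul, Measure.integral_comp_mul_left
      (fun u => gauss u * Real.exp (-(a ^ α * |u| ^ α))) a⁻¹, inv_inv, abs_of_pos ha, smul_eq_mul,
      ← mul_assoc, inv_mul_cancel₀ ha.ne', one_mul]
  · have := ((exp_sq_int ha).mul_prod (exp_stable_int h0)).const_mul (2 * Real.pi)⁻¹
    have h4 := this.bdd_mul (c := 1) (f := fun q : ℝ × ℝ => Real.cos (q.2 * q.1))
        (Continuous.aestronglyMeasurable (by fun_prop)) (ae_of_all _ fun q =>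
          Real.abs_cos_le_one _)
    refine h4.congr (ae_of_all _ fun q => ?_)
    simp only [Function.uncurry]; ring

lemma stable_damped_int {α : ℝ} (h0 : 0 < α) {a : ℝ} (ha : 0 < a) :
    Integrable fun z => stableDensity α z * Real.exp (-((a * z) ^ 2 / 2)) := by
  refine (exp_sq_int ha).bdd_mul (c := (2 * Real.pi)⁻¹ * ∫ u, Real.exp (-(|u| ^ α)))
    (stable_cont h0).aestronglyMeasurable (ae_of_all _ fun z => ?_)
  rw [stableDensity, norm_mul, Real.norm_of_nonneg (by positivity)]
  refine mul_le_mul_of_nonneg_left ?_ (by positivity)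
  refine norm_integral_le_of_norm_le (exp_stable_int h0) (ae_of_all _ fun u => ?_)
  rw [norm_mul, Real.norm_of_nonneg (Real.exp_pos _).le]
  exact mul_le_of_le_one_left (Real.exp_pos _).le (Real.abs_cos_le_one _)

lemma stable_gauss_bounds {α : ℝ} (h0 : 0 < α) (h2 : α < 2) {a : ℝ} (ha : 0 < a) :
    1 - a ^ α * C0 α ≤ ∫ z, stableDensity α z * Real.exp (-((a * z) ^ 2 / 2)) ∧
    ∫ z, stableDensity α z * Real.exp (-((a * z) ^ 2 / 2)) ≤ 1 := by
  rw [stable_gauss h0 ha]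
  have hle : ∀ u : ℝ, Real.exp (-(a ^ α * |u| ^ α)) ≤ 1 := fun u => by
    rw [Real.exp_le_one_iff]
    have : 0 ≤ a ^ α * |u| ^ α := by positivity
    linarith
  have hi : Integrable fun u => gauss u * Real.exp (-(a ^ α * |u| ^ α)) := by
    refine gauss_int.mul_bdd (c := 1) ?_ (ae_of_all _ fun u => ?_)
    · have : Continuous fun u : ℝ => |u| ^ α := continuous_abs.rpow_const fun _ => Or.inr h0.le
      exact Continuous.aestronglyMeasurable (by fun_prop)
    · rw [Real.norm_of_nonneg (Real.exp_pos _).le]; exact hle u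
  constructor
  · have : 1 - a ^ α * C0 α = ∫ u, (gauss u - a ^ α * (gauss u * |u| ^ α)) := by
      rw [integral_sub gauss_int ((gauss_abs_int h0 h2).const_mul _), gauss_integral,
        integral_const_mul, C0]
    rw [this]
    refine integral_mono (gauss_int.sub ((gauss_abs_int h0 h2).const_mul _)) hi fun u => ?_
    have h3 := Real.add_one_le_exp (-(a ^ α * |u| ^ α))
    have := mul_le_mul_of_nonneg_left h3 (gauss_pos u).le
    simp only
    nlinarith
  · rw [← gauss_integral]
    exact integral_mono hi gauss_int fun u => mul_le_of_le_one_right (gauss_pos u).le (hle u)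

lemma stable_damped_tendsto (α z : ℝ) : Tendsto (fun n : ℕ => stableDensity α z *
    Real.exp (-((1 / ((n : ℝ) + 1) * z) ^ 2 / 2))) atTop (𝓝 (stableDensity α z)) := by
  have h := (((tendsto_one_div_add_atTop_nhds_zero_nat (𝕜 := ℝ)).mul_const z).pow 2).div_const 2
  have := ((Real.continuous_exp.tendsto _).comp h.neg).const_mul (stableDensity α z)
  simpa [Function.comp_def] using this

lemma stable_int {α : ℝ} (h0 : 0 < α) (h2 : α < 2) : Integrable (stableDensity α) := by
  have hd : ∀ n : ℕ, 0 < 1 / ((n : ℝ) + 1) := fun n => by positivity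
  refine ⟨(stable_cont h0).aestronglyMeasurable, ?_⟩
  rw [hasFiniteIntegral_iff_ofReal (ae_of_all _ (stable_nonneg h0 h2))]
  have hlim : ∀ z, liminf (fun n : ℕ => ENNReal.ofReal (stableDensity α z *
      Real.exp (-((1 / ((n : ℝ) + 1) * z) ^ 2 / 2)))) atTop =
      ENNReal.ofReal (stableDensity α z) := fun z =>
    (ENNReal.tendsto_ofReal (stable_damped_tendsto α z)).liminf_eq
  simp_rw [← hlim]
  have hc := stable_cont h0
  refine lt_of_le_of_lt (lintegral_liminf_le fun n => ?_) ?_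
  · exact Measurable.ennreal_ofReal (Continuous.measurable (by fun_prop))
  · refine lt_of_le_of_lt (liminf_le_of_frequently_le' (x := 1) (Frequently.of_forall fun n => ?_))
      ENNReal.one_lt_top
    rw [← ofReal_integral_eq_lintegral_ofReal (stable_damped_int h0 (hd n))
      (ae_of_all _ fun z => mul_nonneg (stable_nonneg h0 h2 z) (Real.exp_pos _).le)]
    exact ENNReal.ofReal_le_one.2 (stable_gauss_bounds h0 h2 (hd n)).2

lemma stable_integral {α : ℝ} (h0 : 0 < α) (h2 : α < 2) : ∫ z, stableDensity α z = 1 := by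
  have hd : ∀ n : ℕ, 0 < 1 / ((n : ℝ) + 1) := fun n => by positivity
  have ht := tendsto_integral_of_dominated_convergence (μ := volume) (stableDensity α)
      (F := fun (n : ℕ) z => stableDensity α z * Real.exp (-((1 / ((n : ℝ) + 1) * z) ^ 2 / 2)))
      (fun n => (stable_damped_int h0 (hd n)).aestronglyMeasurable)
      (stable_int h0 h2) (fun n => ae_of_all _ fun z => by
        rw [norm_mul, Real.norm_of_nonneg (Real.exp_pos _).le,
          Real.norm_of_nonneg (stable_nonneg h0 h2 z)]
        refine mul_le_of_le_one_right (stable_nonneg h0 h2 z) ?_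
        rw [Real.exp_le_one_iff]
        have := sq_nonneg (1 / ((n : ℝ) + 1) * z)
        linarith)
      (ae_of_all _ fun z => stable_damped_tendsto α z)
  refine le_antisymm (le_of_tendsto' ht fun n => (stable_gauss_bounds h0 h2 (hd n)).2) ?_
  have hl : Tendsto (fun n : ℕ => 1 - (1 / ((n : ℝ) + 1)) ^ α * C0 α) atTop (𝓝 1) := by
    have h := (tendsto_one_div_add_atTop_nhds_zero_nat (𝕜 := ℝ)).rpow_const (p := α) (Or.inr h0.le)
    rw [Real.zero_rpow h0.ne'] at h
    simpa using (h.mul_const (C0 α)).const_sub 1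
  exact le_of_tendsto_of_tendsto' hl ht fun n => (stable_gauss_bounds h0 h2 (hd n)).1

def qtail (α w z : ℝ) : ℝ := (1 - Real.exp (-((w * z) ^ 2 / 2))) * stableDensity α z

lemma qtail_int {α : ℝ} (h0 : 0 < α) (h2 : α < 2) {w : ℝ} (hw : 0 < w) :
    Integrable (qtail α w) := by
  refine ((stable_int h0 h2).sub (stable_damped_int h0 hw)).congr (ae_of_all _ fun z => ?_)
  simp only [qtail, Pi.sub_apply]; ring

lemma qtail_le {α : ℝ} (h0 : 0 < α) (h2 : α < 2) {w : ℝ} (hw : 0 < w) :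
    ∫ z, qtail α w z ≤ w ^ α * C0 α := by
  have : ∫ z, qtail α w z = (∫ z, stableDensity α z) -
      ∫ z, stableDensity α z * Real.exp (-((w * z) ^ 2 / 2)) := by
    rw [← integral_sub (stable_int h0 h2) (stable_damped_int h0 hw)]
    refine integral_congr_ae (ae_of_all _ fun z => ?_)
    simp only [qtail]; ring
  rw [this, stable_integral h0 h2]
  have := (stable_gauss_bounds h0 h2 hw).1
  linarith


lemma conv_prod_int {F q : ℝ → ℝ} (hc : Continuous F) (hF : Integrable F) (hq : Integrable q)
    (w : ℝ) : Integrable (fun p : ℝ × ℝ => F (p.1 - w * p.2) * q p.2) (volume.prod volume) := by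
  have hm : AEStronglyMeasurable (fun p : ℝ × ℝ => F (p.1 - w * p.2) * q p.2)
      (volume.prod volume) :=
    (Continuous.aestronglyMeasurable (by fun_prop)).mul hq.aestronglyMeasurable.comp_snd
  rw [integrable_prod_iff' hm]
  refine ⟨ae_of_all _ fun z => (hF.comp_sub_right (w * z)).mul_const (q z), ?_⟩
  have : ∀ z, ∫ y, ‖F (y - w * z) * q z‖ = (∫ y, ‖F y‖) * ‖q z‖ := by
    intro z
    simp_rw [norm_mul]
    rw [integral_mul_const, integral_sub_right_eq_self (fun y => ‖F y‖)]
  simp_rw [this]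
  exact hq.norm.const_mul _

lemma conv_integral {F q : ℝ → ℝ} (hc : Continuous F) (hF : Integrable F) (hq : Integrable q)
    (w : ℝ) : ∫ y, ∫ z, F (y - w * z) * q z = (∫ y, F y) * ∫ z, q z := by
  rw [integral_integral_swap (conv_prod_int hc hF hq w), ← integral_const_mul]
  refine integral_congr_ae (ae_of_all _ fun z => ?_)
  simp only
  rw [integral_mul_const, integral_sub_right_eq_self]

lemma conv_integrable {F q : ℝ → ℝ} (hc : Continuous F) (hF : Integrable F) (hq : Integrable q)
    (w : ℝ) : Integrable fun y => ∫ z, F (y - w * z) * q z :=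
  (conv_prod_int hc hF hq w).integral_prod_left

lemma conv_ae {F q : ℝ → ℝ} (hc : Continuous F) (hF : Integrable F) (hq : Integrable q)
    (w : ℝ) : ∀ᵐ y, Integrable fun z => F (y - w * z) * q z :=
  (conv_prod_int hc hF hq w).prod_right_ae

lemma gauss_hasDeriv (y : ℝ) : HasDerivAt gauss (-(y * gauss y)) y := by
  unfold gauss
  have h : HasDerivAt (fun y : ℝ => -(y ^ 2) / 2) (-y) y := by
    have := ((hasDerivAt_pow 2 y).neg).div_const 2
    exact this.congr_deriv (by push_cast; ring)
  have := h.exp.const_mul (Real.sqrt (2 * Real.pi))⁻¹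
  exact this.congr_deriv (by ring)

lemma Dop_gauss (y : ℝ) : Dop gauss y = (1 - y ^ 2) * gauss y := by
  rw [Dop, (gauss_hasDeriv y).deriv]; ring

lemma Hg_int : Integrable fun y => (1 - y ^ 2) * gauss y := by
  refine (gauss_int.sub (gauss_pow_int 2)).congr (ae_of_all _ fun y => ?_)
  simp only [Pi.sub_apply]; ring

lemma HHg_int : Integrable fun y => (1 - y ^ 2) ^ 2 * gauss y := by
  refine ((gauss_int.sub ((gauss_pow_int 2).const_mul 2)).add (gauss_pow_int 4)).congr
    (ae_of_all _ fun y => ?_)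
  simp only [Pi.sub_apply, Pi.add_apply]; ring

lemma moment_two : ∫ y : ℝ, (1 - y ^ 2) ^ 2 * gauss y = 2 := by
  have hd : ∀ y, HasDerivAt (fun y => (y ^ 3 + y) * gauss y)
      ((3 * y ^ 2 + 1) * gauss y + (y ^ 3 + y) * (-(y * gauss y))) y := by
    intro y
    have h1 := ((hasDerivAt_pow 3 y).add (hasDerivAt_id y)).mul (gauss_hasDeriv y)
    exact h1.congr_deriv (by simp)
  have e : ∀ y : ℝ, (3 * y ^ 2 + 1) * gauss y + (y ^ 3 + y) * (-(y * gauss y)) =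
      2 * gauss y - (1 - y ^ 2) ^ 2 * gauss y := fun y => by ring
  simp_rw [e] at hd
  have hi : Integrable fun y => (y ^ 3 + y) * gauss y := by
    refine ((gauss_pow_int 3).add (gauss_pow_int 1)).congr (ae_of_all _ fun y => ?_)
    simp only [Pi.add_apply]; ring
  have := integral_eq_zero_of_hasDerivAt_of_integrable hd
    ((gauss_int.const_mul 2).sub HHg_int) hi
  rw [integral_sub (gauss_int.const_mul 2) HHg_int, integral_const_mul, gauss_integral] at this
  linarith

lemma Dop_moment : ∫ y : ℝ, Dop gauss y ^ 2 / gauss y = 2 := by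
  rw [← moment_two]
  refine integral_congr_ae (ae_of_all _ fun y => ?_)
  simp only [Dop_gauss]
  have := (gauss_pos y).ne'
  field_simp

/-- Truncated score. -/
def hT (ε y : ℝ) : ℝ := 1 - y ^ 2 / (1 + ε * y ^ 2)

lemma aux_div (ε a : ℝ) (h0 : 0 < ε) (h1 : ε ≤ 1) : |a| / (1 + ε * a ^ 2) ≤ 1 / (2 * ε) := by
  rw [div_le_div_iff₀ (by positivity) (by positivity)]
  have : ε * a ^ 2 ≥ (ε * |a|) ^ 2 := by
    rw [mul_pow, sq_abs]
    have := mul_nonneg (mul_nonneg h0.le (sub_nonneg.2 h1)) (sq_nonneg a)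
    nlinarith
  nlinarith [sq_nonneg (1 - ε * |a|)]

lemma hT_lip (ε a b : ℝ) (h0 : 0 < ε) (h1 : ε ≤ 1) :
    |hT ε a - hT ε b| ≤ |a - b| / ε := by
  have pa : 0 < 1 + ε * a ^ 2 := by positivity
  have pb : 0 < 1 + ε * b ^ 2 := by positivity
  have e : hT ε a - hT ε b = (b - a) * (a / (1 + ε * a ^ 2) / (1 + ε * b ^ 2) +
      b / (1 + ε * b ^ 2) / (1 + ε * a ^ 2)) := by
    unfold hT; field_simp; ring
  have bd : ∀ x y : ℝ, |x / (1 + ε * x ^ 2) / (1 + ε * y ^ 2)| ≤ 1 / (2 * ε) := by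
    intro x y
    have px : 0 < 1 + ε * x ^ 2 := by positivity
    have py : 1 ≤ 1 + ε * y ^ 2 := by
      have : 0 ≤ ε * y ^ 2 := by positivity
      linarith
    rw [abs_div, abs_div, abs_of_pos px, abs_of_pos (zero_lt_one.trans_le py)]
    exact (div_le_self (by positivity) py).trans (aux_div ε x h0 h1)
  rw [e, abs_mul, abs_sub_comm]
  calc _ ≤ |a - b| * (1 / (2 * ε) + 1 / (2 * ε)) :=
        mul_le_mul_of_nonneg_left ((abs_add_le _ _).trans (add_le_add (bd a b) (bd b a)))
          (abs_nonneg _)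
    _ = _ := by field_simp; norm_num

lemma hT_bdd (ε a b : ℝ) (h0 : 0 < ε) : |hT ε a - hT ε b| ≤ 1 / ε := by
  have bd : ∀ x : ℝ, 0 ≤ x ^ 2 / (1 + ε * x ^ 2) ∧ x ^ 2 / (1 + ε * x ^ 2) ≤ 1 / ε := by
    intro x
    refine ⟨by positivity, ?_⟩
    rw [div_le_div_iff₀ (by positivity) h0]; nlinarith
  obtain ⟨a1, a2⟩ := bd a
  obtain ⟨b1, b2⟩ := bd b
  unfold hT
  rw [abs_le]; constructor <;> linarith

lemma hT_sq (ε x b : ℝ) (h0 : 0 < ε) (h1 : ε ≤ 1) :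
    (hT ε (b + x) - hT ε b) ^ 2 ≤ 3 / ε ^ 2 * (1 - Real.exp (-(x ^ 2 / 2))) := by
  have l1 := hT_lip ε (b + x) b h0 h1
  have l2 := hT_bdd ε (b + x) b h0
  rw [add_sub_cancel_left] at l1
  have s1 : (hT ε (b + x) - hT ε b) ^ 2 ≤ x ^ 2 / ε ^ 2 := by
    rw [← sq_abs, ← sq_abs x, ← div_pow]; gcongr
  have s2 : (hT ε (b + x) - hT ε b) ^ 2 ≤ 1 / ε ^ 2 := by
    rw [← sq_abs, ← _root_.one_div_pow]; gcongr
  have hexp : x ^ 2 / (2 + x ^ 2) ≤ 1 - Real.exp (-(x ^ 2 / 2)) := by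
    have h := Real.add_one_le_exp (x ^ 2 / 2)
    have hp : 0 < x ^ 2 / 2 + 1 := by positivity
    have : Real.exp (-(x ^ 2 / 2)) ≤ (x ^ 2 / 2 + 1)⁻¹ := by
      rw [Real.exp_neg]; exact inv_anti₀ hp h
    have e : x ^ 2 / (2 + x ^ 2) = 1 - (x ^ 2 / 2 + 1)⁻¹ := by field_simp; ring
    linarith
  set D := (hT ε (b + x) - hT ε b) ^ 2
  have hD : D * ε ^ 2 ≤ 3 * (x ^ 2 / (2 + x ^ 2)) := by
    rw [le_div_iff₀ (by positivity)] at s1 s2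
    rw [← mul_div_assoc, le_div_iff₀ (by positivity)]
    have : 0 ≤ D * ε ^ 2 := by positivity
    nlinarith [sq_nonneg x]
  rw [div_mul_eq_mul_div, le_div_iff₀ (by positivity)]
  linarith

lemma hT_approx (ε b : ℝ) (h0 : 0 < ε) : (hT ε b - (1 - b ^ 2)) ^ 2 ≤ ε ^ 2 * b ^ 8 := by
  have e : hT ε b - (1 - b ^ 2) = ε * b ^ 4 / (1 + ε * b ^ 2) := by
    unfold hT; field_simp; ring
  have h1 : 1 ≤ 1 + ε * b ^ 2 := by
    have : 0 ≤ ε * b ^ 2 := by positivity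
    linarith
  have h2 : ε * b ^ 4 / (1 + ε * b ^ 2) ≤ ε * b ^ 4 := div_le_self (by positivity) h1
  rw [e]
  calc _ ≤ (ε * b ^ 4) ^ 2 := by gcongr
    _ = _ := by ring

lemma hT_total (ε x b : ℝ) (h0 : 0 < ε) (h1 : ε ≤ 1) :
    (hT ε (b + x) - (1 - b ^ 2)) ^ 2 ≤
      6 / ε ^ 2 * (1 - Real.exp (-(x ^ 2 / 2))) + 2 * ε ^ 2 * b ^ 8 := by
  have a1 := hT_sq ε x b h0 h1
  have a2 := hT_approx ε b h0
  have e : 6 / ε ^ 2 * (1 - Real.exp (-(x ^ 2 / 2))) =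
    2 * (3 / ε ^ 2 * (1 - Real.exp (-(x ^ 2 / 2)))) := by ring
  rw [e]
  nlinarith [sq_nonneg (hT ε (b + x) - hT ε b - (hT ε b - (1 - b ^ 2)))]

def M8 : ℝ := ∫ y, y ^ 8 * gauss y

lemma M8_nonneg : 0 ≤ M8 := integral_nonneg fun y => mul_nonneg (by positivity) (gauss_pos y).le

/-- quadratic form lemma -/
lemma quad_aux (f g k : ℝ) (hf : 0 ≤ f) (hQ : ∀ c : ℝ, 0 ≤ k - 2 * c * g + c ^ 2 * f) :
    g ^ 2 / f ≤ k ∧ ∀ c : ℝ, 2 * c * g - c ^ 2 * f ≤ g ^ 2 / f := by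
  rcases hf.eq_or_lt with h | h
  · subst h
    have hg : g = 0 := by
      by_contra hg
      have := hQ ((k + 1) / (2 * g))
      have e : 2 * ((k + 1) / (2 * g)) * g = k + 1 := by field_simp
      rw [e] at this; linarith
    subst hg
    have := hQ 0
    simp at this ⊢
    exact this
  · constructor
    · have := hQ (g / f)
      have e : k - 2 * (g / f) * g + (g / f) ^ 2 * f = k - g ^ 2 / f := by field_simp; ring
      linarith
    · intro c
      have e : g ^ 2 / f - (2 * c * g - c ^ 2 * f) = (g - c * f) ^ 2 / f := by field_simp; ring
      have : 0 ≤ (g - c * f) ^ 2 / f := by positivity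
      linarith

lemma main_bound {α : ℝ} (h0 : 0 < α) (h2 : α < 2) {w ε : ℝ} (hw : 0 < w) (he : 0 < ε)
    (he1 : ε ≤ 1) :
    |(∫ y : ℝ, gFun α y w ^ 2 / fFun α y w) - 2| ≤
      6 / ε ^ 2 * (w ^ α * C0 α) + 2 * ε ^ 2 * M8 := by
  set p := stableDensity α with hp
  have pint : Integrable p := stable_int h0 h2
  have p0 : ∀ z, 0 ≤ p z := stable_nonneg h0 h2
  have p1 : ∫ z, p z = 1 := stable_integral h0 h2
  have qint := qtail_int h0 h2 hw
  have gc := gauss_cont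
  have c1 : Continuous fun y => (1 - y ^ 2) * gauss y := by fun_prop
  have c2 : Continuous fun y => (1 - y ^ 2) ^ 2 * gauss y := by fun_prop
  have c8 : Continuous fun y => y ^ 8 * gauss y := by fun_prop
  let f : ℝ → ℝ := fun y => ∫ z, gauss (y - w * z) * p z
  let g : ℝ → ℝ := fun y => ∫ z, (1 - (y - w * z) ^ 2) * gauss (y - w * z) * p z
  let k : ℝ → ℝ := fun y => ∫ z, (1 - (y - w * z) ^ 2) ^ 2 * gauss (y - w * z) * p z
  let r : ℝ → ℝ := fun y => ∫ z, gauss (y - w * z) * qtail α w z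
  let m : ℝ → ℝ := fun y => ∫ z, (y - w * z) ^ 8 * gauss (y - w * z) * p z
  have hfF : ∀ y, fFun α y w = f y := fun y => rfl
  have hgF : ∀ y, gFun α y w = g y := fun y => by
    simp only [gFun, Dop_gauss, g, hp]
  simp_rw [hfF, hgF]
  have fi : Integrable f := conv_integrable gc gauss_int pint w
  have gi : Integrable g := conv_integrable c1 Hg_int pint w
  have ki : Integrable k := conv_integrable c2 HHg_int pint w
  have ri : Integrable r := conv_integrable gc gauss_int qint w
  have mi : Integrable m := conv_integrable c8 (gauss_pow_int 8) pint w
  have kI : ∫ y, k y = 2 := by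
    have := conv_integral c2 HHg_int pint w
    rw [moment_two, p1, mul_one] at this; exact this
  have rI : ∫ y, r y ≤ w ^ α * C0 α := by
    have := conv_integral gc gauss_int qint w
    rw [gauss_integral, one_mul] at this
    exact this.le.trans (qtail_le h0 h2 hw)
  have mI : ∫ y, m y = M8 := by
    have := conv_integral c8 (gauss_pow_int 8) pint w
    rw [p1, mul_one] at this; exact this
  have key : ∀ᵐ y, 0 ≤ g y ^ 2 / f y ∧ g y ^ 2 / f y ≤ k y ∧
      k y - (6 / ε ^ 2 * r y + 2 * ε ^ 2 * m y) ≤ g y ^ 2 / f y := by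
    filter_upwards [conv_ae gc gauss_int pint w, conv_ae c1 Hg_int pint w,
      conv_ae c2 HHg_int pint w, conv_ae gc gauss_int qint w,
      conv_ae c8 (gauss_pow_int 8) pint w] with y fy gy ky ry my
    have f0 : 0 ≤ f y := integral_nonneg fun z => mul_nonneg (gauss_pos _).le (p0 z)
    have qi : ∀ c : ℝ, Integrable fun z => (1 - (y - w * z) ^ 2) ^ 2 * gauss (y - w * z) * p z -
        2 * c * ((1 - (y - w * z) ^ 2) * gauss (y - w * z) * p z) +
        c ^ 2 * (gauss (y - w * z) * p z) := fun c =>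
      (ky.sub (gy.const_mul (2 * c))).add (fy.const_mul (c ^ 2))
    have qe : ∀ c : ℝ, k y - 2 * c * g y + c ^ 2 * f y =
        ∫ z, ((1 - (y - w * z) ^ 2) ^ 2 * gauss (y - w * z) * p z -
        2 * c * ((1 - (y - w * z) ^ 2) * gauss (y - w * z) * p z) +
        c ^ 2 * (gauss (y - w * z) * p z)) := by
      intro c
      have kg : Integrable fun z => (1 - (y - w * z) ^ 2) ^ 2 * gauss (y - w * z) * p z -
          2 * c * ((1 - (y - w * z) ^ 2) * gauss (y - w * z) * p z) := ky.sub (gy.const_mul (2 * c))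
      rw [integral_add kg (fy.const_mul (c ^ 2)),
        integral_sub ky (gy.const_mul (2 * c)), integral_const_mul, integral_const_mul]
    have qs : ∀ c z : ℝ, ((1 - (y - w * z) ^ 2) ^ 2 * gauss (y - w * z) * p z -
        2 * c * ((1 - (y - w * z) ^ 2) * gauss (y - w * z) * p z) +
        c ^ 2 * (gauss (y - w * z) * p z)) =
        (c - (1 - (y - w * z) ^ 2)) ^ 2 * (gauss (y - w * z) * p z) := fun c z => by ring
    have gp : ∀ z, 0 ≤ gauss (y - w * z) * p z := fun z => mul_nonneg (gauss_pos _).le (p0 z)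
    have hQ : ∀ c : ℝ, 0 ≤ k y - 2 * c * g y + c ^ 2 * f y := by
      intro c
      rw [qe]
      refine integral_nonneg fun z => ?_
      simp only [Pi.zero_apply]
      rw [qs]; exact mul_nonneg (sq_nonneg _) (gp z)
    obtain ⟨b1, b2⟩ := quad_aux _ _ _ f0 hQ
    refine ⟨by positivity, b1, ?_⟩
    have b3 := b2 (hT ε y)
    have b4 : k y - 2 * hT ε y * g y + hT ε y ^ 2 * f y ≤
        6 / ε ^ 2 * r y + 2 * ε ^ 2 * m y := by
      rw [qe]
      have : 6 / ε ^ 2 * r y + 2 * ε ^ 2 * m y = ∫ z,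
          (6 / ε ^ 2 * (gauss (y - w * z) * qtail α w z) +
            2 * ε ^ 2 * ((y - w * z) ^ 8 * gauss (y - w * z) * p z)) := by
        rw [integral_add (ry.const_mul _) (my.const_mul _), integral_const_mul, integral_const_mul]
      rw [this]
      refine integral_mono (qi _) ((ry.const_mul _).add (my.const_mul _)) fun z => ?_
      simp only
      rw [qs]
      have t := hT_total ε (w * z) (y - w * z) he he1
      rw [sub_add_cancel] at t
      have := mul_le_mul_of_nonneg_right t (gp z)
      refine this.trans (le_of_eq ?_)
      simp only [qtail, hp]; ring
    linarith
  have Gi : Integrable fun y => g y ^ 2 / f y := by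
    refine ki.mono' ?_ ?_
    · exact ((gi.aestronglyMeasurable.aemeasurable.pow_const 2).div
        fi.aestronglyMeasurable.aemeasurable).aestronglyMeasurable
    · filter_upwards [key] with y hy
      rw [Real.norm_of_nonneg hy.1]; exact hy.2.1
  have up : ∫ y, g y ^ 2 / f y ≤ 2 := by
    rw [← kI]
    exact integral_mono_ae Gi ki (key.mono fun y hy => hy.2.1)
  have R1 : Integrable fun y => 6 / ε ^ 2 * r y + 2 * ε ^ 2 * m y :=
    (ri.const_mul _).add (mi.const_mul _)
  have lo : 2 - (6 / ε ^ 2 * (w ^ α * C0 α) + 2 * ε ^ 2 * M8) ≤ ∫ y, g y ^ 2 / f y := by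
    have kR : Integrable fun y => k y - (6 / ε ^ 2 * r y + 2 * ε ^ 2 * m y) := ki.sub R1
    have h := integral_mono_ae kR Gi (key.mono fun y hy => hy.2.2)
    rw [integral_sub ki R1, kI, integral_add (ri.const_mul _) (mi.const_mul _),
      integral_const_mul, integral_const_mul, mI] at h
    have : 6 / ε ^ 2 * ∫ y, r y ≤ 6 / ε ^ 2 * (w ^ α * C0 α) :=
      mul_le_mul_of_nonneg_left rI (by positivity)
    linarith
  have nn : 0 ≤ 6 / ε ^ 2 * (w ^ α * C0 α) + 2 * ε ^ 2 * M8 := by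
    have := C0_nonneg α
    have := M8_nonneg
    positivity
  rw [abs_le]; constructor <;> linarith

/-- `∫ g_α² / f_α → 2`, with rate `n^{-(1-α/2)/2}`; here
`2 = ∫ (Dφ)²/φ = ∫ (1-y²)² φ(y) dy`. -/
theorem statement19 (σ₀ δ₀ α₀ : ℝ) (hσ : 0 < σ₀) (hδ : 0 < δ₀)
    (hα : α₀ ∈ Set.Ioo (0 : ℝ) 2) :
    (∫ y : ℝ, Dop gauss y ^ 2 / gauss y) = 2 ∧
    (∫ y : ℝ, (1 - y ^ 2) ^ 2 * gauss y) = 2 ∧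
    ∃ C > (0 : ℝ), ∃ N : ℕ, ∀ n ≥ N,
      |(∫ y : ℝ, gFun α₀ y (wn n σ₀ δ₀ α₀) ^ 2 / fFun α₀ y (wn n σ₀ δ₀ α₀)) - 2| ≤
        C * (n : ℝ) ^ (-(1 - α₀ / 2) / 2) := by
  obtain ⟨h0, h2⟩ := hα
  refine ⟨Dop_moment, moment_two, 6 * ((δ₀ / σ₀) ^ α₀ * C0 α₀) + 2 * M8 + 1, ?_, 1, ?_⟩
  · have := C0_nonneg α₀
    have := M8_nonneg
    positivity
  · intro n hn
    have hn1 : (1:ℝ) ≤ n := by exact_mod_cast hn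
    have hn0 : (0:ℝ) < n := by linarith
    have hw : 0 < wn n σ₀ δ₀ α₀ := by unfold wn; positivity
    have he : 0 < (n : ℝ) ^ (-(1 - α₀ / 2) / 4) := by positivity
    have he1 : (n : ℝ) ^ (-(1 - α₀ / 2) / 4) ≤ 1 :=
      Real.rpow_le_one_of_one_le_of_nonpos hn1 (by linarith)
    refine (main_bound h0 h2 hw he he1).trans ?_
    have e1 : ((n : ℝ) ^ (-(1 - α₀ / 2) / 4)) ^ 2 = (n : ℝ) ^ (-(1 - α₀ / 2) / 2) := by
      rw [← Real.rpow_natCast, ← Real.rpow_mul hn0.le]; congr 1; push_cast; ring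
    have e2 : wn n σ₀ δ₀ α₀ ^ α₀ =
        (δ₀ / σ₀) ^ α₀ * ((n : ℝ) ^ (-(1 - α₀ / 2) / 2)) ^ 2 := by
      rw [wn, mul_div_assoc, Real.mul_rpow (by positivity) (by positivity), mul_comm,
        ← Real.rpow_mul hn0.le, ← Real.rpow_natCast, ← Real.rpow_mul hn0.le]
      congr 2
      field_simp
      ring
    rw [e1, e2]
    set R := (n : ℝ) ^ (-(1 - α₀ / 2) / 2)
    have hR : 0 < R := by positivity
    have e3 : 6 / R * ((δ₀ / σ₀) ^ α₀ * R ^ 2 * C0 α₀) = 6 * ((δ₀ / σ₀) ^ α₀ * C0 α₀) * R := by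
      field_simp
    rw [e3]
    nlinarith

end LevyLAN
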